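/- WOP metrizes weak convergence together with convergence of second moments on M_K(ℝ^d): for K > 0, a sequence (μ_n) in M_K(ℝ^d) and μ ∈ M_K(ℝ^d), WOP(μ_n, μ) → 0 if and only if both M_{x₀}(μ_n) → M_{x₀}(μ) and ∫φ dμ_n → ∫φ dμ for every bounded continuous function φ : ℝ^d → ℝ. -/

import Mathlib

open MeasureTheory

noncomputable section

abbrev Euc (d : ℕ) := EuclideanSpace ℝ (Fin d)

variable {d : ℕ}

/-- Total mass of a measure. -/
def mass (μ : Measure (Euc d)) : ℝ := (μ Set.univ).toReal

/-- Second moment centered at `x₀`. -/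
def sndMoment (x₀ : Euc d) (μ : Measure (Euc d)) : ℝ := ∫ x, ‖x - x₀‖ ^ 2 ∂μ

/-- `μ ∈ M(ℝ^d)`: finite positive measure with finite second moment. -/
def MemM (μ : Measure (Euc d)) : Prop :=
  IsFiniteMeasure μ ∧ Integrable (fun x => ‖x‖ ^ 2) μ

/-- `μ ∈ P₂(ℝ^d)`: probability measure with finite second moment. -/
def MemP2 (μ : Measure (Euc d)) : Prop :=
  IsProbabilityMeasure μ ∧ Integrable (fun x => ‖x‖ ^ 2) μ

/-- Squared 2-Wasserstein distance, as an infimum over couplings. -/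
def W2sq (μ ν : Measure (Euc d)) : ℝ :=
  sInf { r : ℝ | ∃ π : Measure (Euc d × Euc d),
    π.map Prod.fst = μ ∧ π.map Prod.snd = ν ∧ r = ∫ p, ‖p.1 - p.2‖ ^ 2 ∂π }

/-- 2-Wasserstein distance. -/
def W2 (μ ν : Measure (Euc d)) : ℝ := Real.sqrt (W2sq μ ν)

/-- The dilation `T_a(x) = a (x - x₀) + x₀`. -/
def dil (x₀ : Euc d) (a : ℝ) (x : Euc d) : Euc d := a • (x - x₀) + x₀

/-- Normalization `μ̄` of `μ`, with the convention `μ̄ = δ_{x₀}` for the null measure. -/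
def nm (x₀ : Euc d) (μ : Measure (Euc d)) : Measure (Euc d) :=
  if μ Set.univ = 0 then Measure.dirac x₀ else (μ Set.univ)⁻¹ • μ

/-- Squared WOP metric with reference point `x₀`. -/
def WOP2 (x₀ : Euc d) (μ ν : Measure (Euc d)) : ℝ :=
  (mass μ - mass ν) ^ 2 +
    W2sq ((nm x₀ μ).map (dil x₀ (mass μ))) ((nm x₀ ν).map (dil x₀ (mass ν)))

/-- The WOP metric with reference point `x₀`. -/
def WOP (x₀ : Euc d) (μ ν : Measure (Euc d)) : ℝ := Real.sqrt (WOP2 x₀ μ ν)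


/-- `μ ∈ M_K(ℝ^d)`: control of the second moment by the mass. -/
def MemMK (x₀ : Euc d) (K : ℝ) (μ : Measure (Euc d)) : Prop :=
  MemM μ ∧ sndMoment x₀ μ ≤ K * mass μ

/-- The normalized product of two measures of equal mass. -/
def prodCoupling (α β : Measure (Euc d)) : Measure (Euc d × Euc d) :=
  (α Set.univ)⁻¹ • α.prod β

lemma map_fst_prodCoupling (α β : Measure (Euc d)) [IsFiniteMeasure α] [IsFiniteMeasure β]
    (h : α Set.univ = β Set.univ) : (prodCoupling α β).map Prod.fst = α := by
  rw [prodCoupling, Measure.map_smul, Measure.map_fst_prod, smul_smul, ← h]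
  by_cases h0 : α Set.univ = 0
  · simp [Measure.measure_univ_eq_zero.mp h0]
  · rw [ENNReal.inv_mul_cancel h0 (measure_ne_top _ _), one_smul]

lemma map_snd_prodCoupling (α β : Measure (Euc d)) [IsFiniteMeasure α] [IsFiniteMeasure β]
    (h : α Set.univ = β Set.univ) : (prodCoupling α β).map Prod.snd = β := by
  rw [prodCoupling, Measure.map_smul, Measure.map_snd_prod, smul_smul]
  by_cases h0 : α Set.univ = 0
  · simp [Measure.measure_univ_eq_zero.mp (h ▸ h0)]
  · rw [ENNReal.inv_mul_cancel h0 (measure_ne_top _ _), one_smul]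

lemma enorm_sub_sq_le (x₀ x y : Euc d) :
    ‖x - y‖ₑ ^ 2 ≤ 2 * (‖x - x₀‖ₑ ^ 2 + ‖y - x₀‖ₑ ^ 2) := by
  have h : ‖x - y‖ ^ 2 ≤ 2 * (‖x - x₀‖ ^ 2 + ‖y - x₀‖ ^ 2) := by
    have h1 : ‖x - y‖ ≤ ‖x - x₀‖ + ‖y - x₀‖ := by
      simpa using norm_sub_le (x - x₀) (y - x₀)
    nlinarith [norm_nonneg (x - y), sq_nonneg (‖x - x₀‖ - ‖y - x₀‖)]
  have h2 := ENNReal.ofReal_le_ofReal h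
  rwa [ENNReal.ofReal_mul (by norm_num), ENNReal.ofReal_add (by positivity) (by positivity),
    ENNReal.ofReal_pow (norm_nonneg _), ENNReal.ofReal_pow (norm_nonneg _),
    ENNReal.ofReal_pow (norm_nonneg _), ofReal_norm, ofReal_norm, ofReal_norm,
    ENNReal.ofReal_ofNat] at h2

lemma lintegral_cost_le_of_marginals (x₀ : Euc d) {α β : Measure (Euc d)}
    {π : Measure (Euc d × Euc d)} (h1 : π.map Prod.fst = α) (h2 : π.map Prod.snd = β) :
    ∫⁻ p, ‖p.1 - p.2‖ₑ ^ 2 ∂π ≤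
      2 * (∫⁻ x, ‖x - x₀‖ₑ ^ 2 ∂α + ∫⁻ x, ‖x - x₀‖ₑ ^ 2 ∂β) := by
  have hm : Measurable fun x : Euc d => ‖x - x₀‖ₑ ^ 2 := by fun_prop
  rw [← h1, ← h2, lintegral_map hm measurable_fst, lintegral_map hm measurable_snd,
    ← lintegral_add_left (by fun_prop), ← lintegral_const_mul _ (by fun_prop)]
  exact lintegral_mono fun p => enorm_sub_sq_le x₀ p.1 p.2

open scoped ENNReal in
lemma lintegral_cost_prodCoupling_le {α β : Measure (Euc d)} [IsFiniteMeasure α]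
    [IsFiniteMeasure β] (h : α Set.univ = β Set.univ) (c : ℝ≥0∞)
    (hc : ∀ᵐ x ∂α, ∀ᵐ y ∂β, ‖x - y‖ₑ ^ 2 ≤ c) :
    ∫⁻ p, ‖p.1 - p.2‖ₑ ^ 2 ∂(prodCoupling α β) ≤ c * α Set.univ := by
  rw [prodCoupling, lintegral_smul_measure, lintegral_prod _ (by fun_prop)]
  by_cases h0 : α Set.univ = 0
  · simp [Measure.measure_univ_eq_zero.mp h0]
  have : ∫⁻ x, ∫⁻ y, ‖x - y‖ₑ ^ 2 ∂β ∂α ≤ c * α Set.univ * α Set.univ := by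
    calc _ ≤ ∫⁻ x, c * α Set.univ ∂α := by
          refine lintegral_mono_ae ?_
          filter_upwards [hc] with x hx
          calc _ ≤ ∫⁻ y, c ∂β := lintegral_mono_ae hx
            _ = _ := by rw [lintegral_const, h]
      _ = _ := by rw [lintegral_const]
  calc _ ≤ (α Set.univ)⁻¹ * (c * α Set.univ * α Set.univ) := by
        rw [smul_eq_mul]; gcongr
    _ = ((α Set.univ)⁻¹ * α Set.univ) * (c * α Set.univ) := by ring
    _ = _ := by rw [ENNReal.inv_mul_cancel h0 (measure_ne_top _ _), one_mul]

lemma W2sq_nonneg (μ ν : Measure (Euc d)) : 0 ≤ W2sq μ ν := by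
  refine Real.sInf_nonneg ?_
  rintro r ⟨π, -, -, rfl⟩
  positivity

lemma W2sq_le_integral {μ ν : Measure (Euc d)} {π : Measure (Euc d × Euc d)}
    (h1 : π.map Prod.fst = μ) (h2 : π.map Prod.snd = ν) :
    W2sq μ ν ≤ ∫ p, ‖p.1 - p.2‖ ^ 2 ∂π := by
  refine csInf_le ⟨0, ?_⟩ ⟨π, h1, h2, rfl⟩
  rintro r ⟨π, -, -, rfl⟩
  positivity

lemma W2sq_le_of_lintegral_le {μ ν : Measure (Euc d)} {π : Measure (Euc d × Euc d)}
    (h1 : π.map Prod.fst = μ) (h2 : π.map Prod.snd = ν) {c : ℝ} (hc : 0 ≤ c)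
    (h : ∫⁻ p, ‖p.1 - p.2‖ₑ ^ 2 ∂π ≤ ENNReal.ofReal c) : W2sq μ ν ≤ c := by
  refine (W2sq_le_integral h1 h2).trans ?_
  rw [integral_eq_lintegral_of_nonneg_ae (Filter.Eventually.of_forall fun p => by positivity)
    (by fun_prop)]
  refine ENNReal.toReal_le_of_le_ofReal hc (le_trans (le_of_eq ?_) h)
  refine lintegral_congr fun p => ?_
  rw [ENNReal.ofReal_pow (norm_nonneg _), ofReal_norm]

lemma le_mul_W2sq_add {μ ν : Measure (Euc d)} [IsProbabilityMeasure μ] [IsProbabilityMeasure ν]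
    {A B c : ℝ} (hA : 0 ≤ A)
    (h : ∀ π : Measure (Euc d × Euc d), π.map Prod.fst = μ → π.map Prod.snd = ν →
      c ≤ A * ∫ p, ‖p.1 - p.2‖ ^ 2 ∂π + B) : c ≤ A * W2sq μ ν + B := by
  have h1 := map_fst_prodCoupling μ ν (by simp)
  have h2 := map_snd_prodCoupling μ ν (by simp)
  rcases hA.eq_or_lt with rfl | hA
  · simpa using h _ h1 h2
  · rw [← sub_le_iff_le_add, ← div_le_iff₀' hA]
    refine le_csInf ⟨_, prodCoupling μ ν, h1, h2, rfl⟩ ?_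
    rintro r ⟨π, h3, h4, rfl⟩
    rw [div_le_iff₀' hA, sub_le_iff_le_add]
    exact h π h3 h4

open scoped ENNReal in
/-- A coupling built from decompositions of the two marginals into finitely many pairs of pieces
of equal mass. -/
lemma exists_coupling_of_sum {ι : Type*} [Fintype ι] (x₀ : Euc d) {α' β' : Measure (Euc d)}
    {α β : ι → Measure (Euc d)} [IsFiniteMeasure α'] [IsFiniteMeasure β']
    [∀ i, IsFiniteMeasure (α i)] [∀ i, IsFiniteMeasure (β i)]
    (h' : α' Set.univ = β' Set.univ) (h : ∀ i, α i Set.univ = β i Set.univ) (c : ℝ≥0∞)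
    (hc : ∀ i, ∀ᵐ x ∂(α i), ∀ᵐ y ∂(β i), ‖x - y‖ₑ ^ 2 ≤ c) :
    ∃ π : Measure (Euc d × Euc d), π.map Prod.fst = α' + ∑ i, α i ∧
      π.map Prod.snd = β' + ∑ i, β i ∧
      ∫⁻ p, ‖p.1 - p.2‖ₑ ^ 2 ∂π ≤
        2 * (∫⁻ x, ‖x - x₀‖ₑ ^ 2 ∂α' + ∫⁻ x, ‖x - x₀‖ₑ ^ 2 ∂β') +
          c * ∑ i, α i Set.univ := by
  refine ⟨prodCoupling α' β' + ∑ i, prodCoupling (α i) (β i), ?_, ?_, ?_⟩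
  · rw [Measure.map_add _ _ measurable_fst, Measure.map_finset_sum measurable_fst.aemeasurable,
      map_fst_prodCoupling _ _ h']
    simp_rw [map_fst_prodCoupling _ _ (h _)]
  · rw [Measure.map_add _ _ measurable_snd, Measure.map_finset_sum measurable_snd.aemeasurable,
      map_snd_prodCoupling _ _ h']
    simp_rw [map_snd_prodCoupling _ _ (h _)]
  · rw [lintegral_add_measure, lintegral_finsetSum_measure, Finset.mul_sum]
    gcongr with i
    · exact lintegral_cost_le_of_marginals x₀ (map_fst_prodCoupling _ _ h')
        (map_snd_prodCoupling _ _ h')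
    · exact lintegral_cost_prodCoupling_le (h i) c (hc i)

open scoped ENNReal in
/-- Two measures sharing a partition of unity are coupled by matching, piece by piece, the common
part of the masses; `f₀` is the unmatched tail. -/
lemma exists_coupling_of_partition {ι : Type*} [Fintype ι] (x₀ : Euc d)
    {μ ν : Measure (Euc d)} [IsProbabilityMeasure μ] [IsProbabilityMeasure ν]
    {f₀ : Euc d → ℝ≥0∞} {f : ι → Euc d → ℝ≥0∞} (hf₀ : Measurable f₀)
    (hf : ∀ i, Measurable (f i)) (hsum : ∀ x, f₀ x + ∑ i, f i x = 1) {c R : ℝ≥0∞}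
    (hc : ∀ i x y, f i x ≠ 0 → f i y ≠ 0 → ‖x - y‖ₑ ^ 2 ≤ c)
    (hR : ∀ i x, f i x ≠ 0 → ‖x - x₀‖ₑ ^ 2 ≤ R) :
    ∃ π : Measure (Euc d × Euc d), π.map Prod.fst = μ ∧ π.map Prod.snd = ν ∧
      ∫⁻ p, ‖p.1 - p.2‖ₑ ^ 2 ∂π ≤
        2 * ((∫⁻ x, f₀ x * ‖x - x₀‖ₑ ^ 2 ∂μ + ∑ i, R * (∫⁻ x, f i x ∂μ - ∫⁻ x, f i x ∂ν)) +
          (∫⁻ x, f₀ x * ‖x - x₀‖ₑ ^ 2 ∂ν + ∑ i, R * (∫⁻ x, f i x ∂ν - ∫⁻ x, f i x ∂μ))) + c := by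
  have hm : Measurable fun x : Euc d => ‖x - x₀‖ₑ ^ 2 := by fun_prop
  have hle : ∀ i x, f i x ≤ 1 := fun i x => by
    rw [← hsum x]
    exact (Finset.single_le_sum (f := fun i => f i x) (fun _ _ => zero_le)
      (Finset.mem_univ i)).trans le_add_self
  have hle₀ : ∀ x, f₀ x ≤ 1 := fun x => by rw [← hsum x]; exact le_self_add
  have hfin : ∀ (g : Euc d → ℝ≥0∞) (ρ : Measure (Euc d)) [IsProbabilityMeasure ρ],
      (∀ x, g x ≤ 1) → IsFiniteMeasure (ρ.withDensity g) := fun g ρ _ hg => by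
    refine isFiniteMeasure_withDensity (ne_of_lt (lt_of_le_of_lt (lintegral_mono hg) ?_))
    simp
  -- the fraction of the piece `i` of `ρ` which is matched
  let t : Measure (Euc d) → Measure (Euc d) → ι → ℝ≥0∞ := fun ρ σ i =>
    min (∫⁻ x, f i x ∂ρ) (∫⁻ x, f i x ∂σ) / ∫⁻ x, f i x ∂ρ
  let α : Measure (Euc d) → Measure (Euc d) → ι → Measure (Euc d) := fun ρ σ i =>
    t ρ σ i • ρ.withDensity (f i)
  let α' : Measure (Euc d) → Measure (Euc d) → Measure (Euc d) := fun ρ σ =>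
    ρ.withDensity f₀ + ∑ i, (1 - t ρ σ i) • ρ.withDensity (f i)
  have ht : ∀ ρ σ i, t ρ σ i ≤ 1 := fun ρ σ i =>
    ENNReal.div_le_of_le_mul (by rw [one_mul]; exact min_le_left _ _)
  have htop : ∀ (ρ : Measure (Euc d)) [IsProbabilityMeasure ρ] i, ∫⁻ x, f i x ∂ρ ≠ ⊤ :=
    fun ρ _ i => ne_of_lt (lt_of_le_of_lt (lintegral_mono (hle i)) (by simp))
  have htmul : ∀ (ρ σ : Measure (Euc d)) [IsProbabilityMeasure ρ] [IsProbabilityMeasure σ] i,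
      t ρ σ i * ∫⁻ x, f i x ∂ρ = min (∫⁻ x, f i x ∂ρ) (∫⁻ x, f i x ∂σ) := fun ρ σ _ _ i => by
    by_cases h0 : ∫⁻ x, f i x ∂ρ = 0
    · simp [h0]
    · exact ENNReal.div_mul_cancel h0 (htop ρ i)
  have hmass : ∀ (ρ σ : Measure (Euc d)) [IsProbabilityMeasure ρ] [IsProbabilityMeasure σ] i,
      α ρ σ i Set.univ = min (∫⁻ x, f i x ∂ρ) (∫⁻ x, f i x ∂σ) := fun ρ σ _ _ i => by
    simp [α, htmul ρ σ i]
  have hdecomp : ∀ (ρ σ : Measure (Euc d)) [IsProbabilityMeasure ρ] [IsProbabilityMeasure σ],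
      α' ρ σ + ∑ i, α ρ σ i = ρ := fun ρ σ _ _ => by
    have h1 : ∀ i, (1 - t ρ σ i) • ρ.withDensity (f i) + α ρ σ i = ρ.withDensity (f i) :=
      fun i => by rw [← add_smul, tsub_add_cancel_of_le (ht ρ σ i), one_smul]
    rw [add_assoc, ← Finset.sum_add_distrib, Finset.sum_congr rfl fun i _ => h1 i]
    ext s hs
    rw [Measure.add_apply, Measure.finsetSum_apply, withDensity_apply _ hs,
      Finset.sum_congr rfl fun i _ => withDensity_apply (f i) hs,
      ← lintegral_finsetSum _ fun i _ => hf i, ← lintegral_add_left hf₀]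
    simp [hsum]
  have hαfin : ∀ (ρ σ : Measure (Euc d)) [IsProbabilityMeasure ρ] [IsProbabilityMeasure σ] i,
      IsFiniteMeasure (α ρ σ i) := fun ρ σ _ _ i => ⟨by
    rw [hmass]; exact (min_le_left _ _).trans_lt (htop ρ i).lt_top⟩
  have hα'fin : ∀ (ρ σ : Measure (Euc d)) [IsProbabilityMeasure ρ] [IsProbabilityMeasure σ],
      IsFiniteMeasure (α' ρ σ) := fun ρ σ _ _ =>
    isFiniteMeasure_of_le ρ (by conv_rhs => rw [← hdecomp ρ σ]
                                exact Measure.le_add_right le_rfl)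
  have hmass' : α' μ ν Set.univ = α' ν μ Set.univ := by
    have h1 := congrArg (fun ρ : Measure (Euc d) => ρ Set.univ) (hdecomp μ ν)
    have h2 := congrArg (fun ρ : Measure (Euc d) => ρ Set.univ) (hdecomp ν μ)
    simp only [Measure.add_apply, Measure.finsetSum_apply, measure_univ, hmass] at h1 h2
    simp_rw [min_comm (∫⁻ x, f _ x ∂ν)] at h2
    refine (ENNReal.add_left_inj ?_).mp (h1.trans h2.symm)
    exact ne_top_of_le_ne_top ENNReal.one_ne_top (le_add_self.trans h1.le)
  have hmom : ∀ (ρ σ : Measure (Euc d)) [IsProbabilityMeasure ρ] [IsProbabilityMeasure σ],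
      ∫⁻ x, ‖x - x₀‖ₑ ^ 2 ∂(α' ρ σ) ≤ ∫⁻ x, f₀ x * ‖x - x₀‖ₑ ^ 2 ∂ρ +
        ∑ i, R * (∫⁻ x, f i x ∂ρ - ∫⁻ x, f i x ∂σ) := fun ρ σ _ _ => by
    rw [lintegral_add_measure, lintegral_finsetSum_measure,
      lintegral_withDensity_eq_lintegral_mul _ hf₀ hm]
    gcongr with i
    · rfl
    · rw [lintegral_smul_measure, lintegral_withDensity_eq_lintegral_mul _ (hf i) hm, smul_eq_mul]
      calc _ ≤ (1 - t ρ σ i) * ∫⁻ x, R * f i x ∂ρ := by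
            gcongr with x
            rw [Pi.mul_apply, mul_comm R]
            by_cases h0 : f i x = 0
            · simp [h0]
            · gcongr
              exact hR i x h0
        _ = R * ((1 - t ρ σ i) * ∫⁻ x, f i x ∂ρ) := by
            rw [lintegral_const_mul _ (hf i)]; ring
        _ = _ := by
            rw [ENNReal.sub_mul fun _ _ => htop ρ i, one_mul, htmul, tsub_min]
  have hae : ∀ (ρ σ : Measure (Euc d)) i, ∀ᵐ x ∂(α ρ σ i), f i x ≠ 0 := fun ρ σ i => by
    refine Measure.ae_smul_measure ?_ _
    rw [ae_withDensity_iff (hf i)]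
    exact Filter.Eventually.of_forall fun x h => h
  have := hα'fin μ ν
  have := hα'fin ν μ
  have := hαfin μ ν
  have := hαfin ν μ
  obtain ⟨π, h1, h2, h3⟩ := exists_coupling_of_sum x₀ (α := α μ ν) (β := α ν μ) hmass'
    (fun i => by rw [hmass, hmass, min_comm]) c (fun i => by
      filter_upwards [hae μ ν i] with x hx
      filter_upwards [hae ν μ i] with y hy
      exact hc i x y hx hy)
  refine ⟨π, h1.trans (hdecomp μ ν), h2.trans (hdecomp ν μ), h3.trans ?_⟩
  gcongr
  · exact hmom μ ν
  · exact hmom ν μ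
  · have h4 := congrArg (fun ρ : Measure (Euc d) => ρ Set.univ) (hdecomp μ ν)
    simp only [Measure.add_apply, Measure.finsetSum_apply, measure_univ] at h4
    calc _ ≤ c * 1 := by gcongr; exact le_add_self.trans h4.le
      _ = c := mul_one c

/-- A continuous partition of unity on `ℝ^d` into a tail and finitely many small bumps. -/
lemma exists_partition_of_unity (x₀ : Euc d) (R : ℝ) {ε : ℝ} (hε : 0 < ε) :
    ∃ (t : Finset (Euc d)) (f₀ : Euc d → ℝ) (f : t → Euc d → ℝ), Continuous f₀ ∧
      (∀ i, Continuous (f i)) ∧ (∀ x, 0 ≤ f₀ x) ∧ (∀ i x, 0 ≤ f i x) ∧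
      (∀ x, f₀ x + ∑ i, f i x = 1) ∧ (∀ x, f₀ x ≠ 0 → R < ‖x - x₀‖) ∧
      (∀ i x y, f i x ≠ 0 → f i y ≠ 0 → ‖x - y‖ ≤ 2 * ε) ∧
      (∀ i x, f i x ≠ 0 → ‖x - x₀‖ ≤ R + ε) := by
  obtain ⟨t, hts, htf, hcov⟩ := finite_cover_balls_of_compact (isCompact_closedBall x₀ R) hε
  lift t to Finset (Euc d) using htf
  let g₀ : Euc d → ℝ := fun x => max 0 (‖x - x₀‖ - R)
  let g : t → Euc d → ℝ := fun i x => max 0 (ε - ‖x - i‖)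
  let S : Euc d → ℝ := fun x => g₀ x + ∑ i, g i x
  have hg₀ : Continuous g₀ := by fun_prop
  have hg : ∀ i, Continuous (g i) := fun i => by fun_prop
  have hS : Continuous S := by fun_prop
  have hg₀n : ∀ x, 0 ≤ g₀ x := fun x => le_max_left _ _
  have hgn : ∀ i x, 0 ≤ g i x := fun i x => le_max_left _ _
  have hSpos : ∀ x, 0 < S x := fun x => by
    by_cases hx : R < ‖x - x₀‖
    · exact add_pos_of_pos_of_nonneg (lt_max_of_lt_right (sub_pos.mpr hx))
        (Finset.sum_nonneg fun i _ => hgn i x)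
    · have hx' : x ∈ Metric.closedBall x₀ R := by
        rw [Metric.mem_closedBall, dist_eq_norm]; exact not_lt.mp hx
      obtain ⟨c, hc, hxc⟩ := Set.mem_iUnion₂.mp (hcov hx')
      rw [Metric.mem_ball, dist_eq_norm] at hxc
      refine add_pos_of_nonneg_of_pos (hg₀n x) (lt_of_lt_of_le ?_
        (Finset.single_le_sum (f := fun i => g i x) (fun i _ => hgn i x)
          (Finset.mem_univ (⟨c, hc⟩ : t))))
      exact lt_max_of_lt_right (sub_pos.mpr hxc)
  have hgε : ∀ i x, g i x / S x ≠ 0 → ‖x - i‖ < ε := fun i x h => by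
    by_contra hcon
    exact h (by simp [g, max_eq_left (sub_nonpos.mpr (not_lt.mp hcon))])
  refine ⟨t, fun x => g₀ x / S x, fun i x => g i x / S x,
    hg₀.div hS fun x => (hSpos x).ne', fun i => (hg i).div hS fun x => (hSpos x).ne',
    fun x => div_nonneg (hg₀n x) (hSpos x).le, fun i x => div_nonneg (hgn i x) (hSpos x).le,
    fun x => ?_, fun x h => ?_, fun i x y hx hy => ?_, fun i x hx => ?_⟩
  · rw [← Finset.sum_div, ← add_div]
    exact div_self (hSpos x).ne'
  · by_contra hcon
    exact h (by simp [g₀, max_eq_left (sub_nonpos.mpr (not_lt.mp hcon))])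
  · have h1 := hgε i x hx
    have h2 := hgε i y hy
    have h3 := norm_sub_le (x - (i : Euc d)) (y - i)
    rw [sub_sub_sub_cancel_right] at h3
    linarith
  · have h1 := hgε i x hx
    have h2 : ‖(i : Euc d) - x₀‖ ≤ R := by
      have := hts i.2
      rwa [Metric.mem_closedBall, dist_eq_norm] at this
    have h3 := norm_add_le (x - (i : Euc d)) (i - x₀)
    rw [sub_add_sub_cancel] at h3
    linarith

lemma exists_tail_integral_lt (x₀ : Euc d) {Q : Measure (Euc d)}
    (hQ : Integrable (fun x => ‖x - x₀‖ ^ 2) Q) {η : ℝ} (hη : 0 < η) :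
    ∃ n : ℕ, ∫ x, {x | (n : ℝ) < ‖x - x₀‖}.indicator (fun x => ‖x - x₀‖ ^ 2) x ∂Q < η := by
  have hmeas : ∀ n : ℕ, MeasurableSet {x : Euc d | (n : ℝ) < ‖x - x₀‖} := fun n =>
    measurableSet_lt measurable_const (by fun_prop)
  have h := tendsto_integral_of_dominated_convergence
    (F := fun (n : ℕ) x => {x | (n : ℝ) < ‖x - x₀‖}.indicator (fun x => ‖x - x₀‖ ^ 2) x)
    (f := fun _ => (0 : ℝ)) (μ := Q) (fun x => ‖x - x₀‖ ^ 2)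
    (fun n => (hQ.indicator (hmeas n)).aestronglyMeasurable) hQ
    (fun n => Filter.Eventually.of_forall fun x => by
      refine (norm_indicator_le_norm_self _ _).trans (le_of_eq ?_)
      rw [Real.norm_of_nonneg (by positivity)])
    (Filter.Eventually.of_forall fun x => by
      obtain ⟨N, hN⟩ := exists_nat_ge ‖x - x₀‖
      refine tendsto_const_nhds.congr' ?_
      filter_upwards [Filter.eventually_ge_atTop N] with n hn
      have : x ∉ {x | (n : ℝ) < ‖x - x₀‖} := by
        simp only [Set.mem_ofPred_eq, not_lt]
        exact hN.trans (by exact_mod_cast hn)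
      rw [Set.indicator_of_notMem this])
  rw [integral_zero] at h
  exact (h.eventually (gt_mem_nhds hη)).exists

open scoped ENNReal in
/-- Weak convergence together with convergence of second moments implies convergence in the
Wasserstein distance. -/
lemma tendsto_W2sq_of_weak (x₀ : Euc d) {P : ℕ → Measure (Euc d)} {Q : Measure (Euc d)}
    [∀ n, IsProbabilityMeasure (P n)] [IsProbabilityMeasure Q]
    (hP : ∀ n, Integrable (fun x => ‖x - x₀‖ ^ 2) (P n))
    (hQ : Integrable (fun x => ‖x - x₀‖ ^ 2) Q)
    (hM : Filter.Tendsto (fun n => sndMoment x₀ (P n)) Filter.atTop (nhds (sndMoment x₀ Q)))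
    (hw : ∀ φ : BoundedContinuousFunction (Euc d) ℝ,
      Filter.Tendsto (fun n => ∫ x, φ x ∂(P n)) Filter.atTop (nhds (∫ x, φ x ∂Q))) :
    Filter.Tendsto (fun n => W2sq (P n) Q) Filter.atTop (nhds 0) := by
  suffices h : ∀ δ : ℝ, 0 < δ → ∀ᶠ n in Filter.atTop, W2sq (P n) Q ≤ δ by
    refine tendsto_order.mpr ⟨fun a ha => Filter.Eventually.of_forall fun n =>
      ha.trans_le (W2sq_nonneg _ _), fun a ha => ?_⟩
    filter_upwards [h (a / 2) (by positivity)] with n hn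
    linarith
  intro δ hδ
  obtain ⟨ε, hε, hεδ⟩ : ∃ ε : ℝ, 0 < ε ∧ (2 * ε) ^ 2 < δ / 2 := by
    refine ⟨Real.sqrt (δ / 16), Real.sqrt_pos.mpr (by positivity), ?_⟩
    rw [mul_pow, Real.sq_sqrt (by positivity)]
    linarith
  obtain ⟨N, hN⟩ := exists_tail_integral_lt x₀ hQ (η := δ / 8) (by positivity)
  obtain ⟨t, f₀, f, hf₀, hf, hf₀n, hfn, hsum, hsupp₀, hdiam, hsupp⟩ :=
    exists_partition_of_unity x₀ N hε
  have hf₀1 : ∀ x, f₀ x ≤ 1 := fun x => by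
    rw [← hsum x]; exact le_add_of_nonneg_right (Finset.sum_nonneg fun i _ => hfn i x)
  have hf1 : ∀ i x, f i x ≤ 1 := fun i x => by
    rw [← hsum x]
    exact (Finset.single_le_sum (f := fun i => f i x) (fun i _ => hfn i x)
      (Finset.mem_univ i)).trans (le_add_of_nonneg_left (hf₀n x))
  -- integrals of the bumps
  have hbump : ∀ i, Filter.Tendsto (fun n => ∫⁻ x, ENNReal.ofReal (f i x) ∂(P n)) Filter.atTop
      (nhds (∫⁻ x, ENNReal.ofReal (f i x) ∂Q)) := fun i => by
    let φ : BoundedContinuousFunction (Euc d) ℝ :=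
      BoundedContinuousFunction.ofNormedAddCommGroup (f i) (hf i) 1 fun x => by
        rw [Real.norm_of_nonneg (hfn i x)]; exact hf1 i x
    have key : ∀ (ρ : Measure (Euc d)) [IsProbabilityMeasure ρ],
        ∫⁻ x, ENNReal.ofReal (f i x) ∂ρ = ENNReal.ofReal (∫ x, φ x ∂ρ) := fun ρ _ =>
      (ofReal_integral_eq_lintegral_ofReal (φ.integrable ρ)
        (Filter.Eventually.of_forall (hfn i))).symm
    simp_rw [key]
    exact ENNReal.tendsto_ofReal (hw φ)
  -- second moments of the tail
  let ψ : BoundedContinuousFunction (Euc d) ℝ :=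
    BoundedContinuousFunction.ofNormedAddCommGroup (fun x => ∑ i, f i x * ‖x - x₀‖ ^ 2)
      (by fun_prop) (∑ _i : t, (N + ε) ^ 2) fun x => by
        rw [Real.norm_of_nonneg (Finset.sum_nonneg fun i _ =>
          mul_nonneg (hfn i x) (by positivity))]
        refine Finset.sum_le_sum fun i _ => ?_
        by_cases h0 : f i x = 0
        · rw [h0, zero_mul]; positivity
        · calc _ ≤ 1 * (N + ε) ^ 2 := by
                gcongr
                · exact hf1 i x
                · exact hsupp i x h0
            _ = _ := one_mul _
  have hf₀eq : ∀ x, f₀ x * ‖x - x₀‖ ^ 2 = ‖x - x₀‖ ^ 2 - ψ x := fun x => by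
    change _ = ‖x - x₀‖ ^ 2 - ∑ i, f i x * ‖x - x₀‖ ^ 2
    rw [← Finset.sum_mul]
    linear_combination ‖x - x₀‖ ^ 2 * hsum x
  have htaileq : ∀ (ρ : Measure (Euc d)) [IsProbabilityMeasure ρ],
      Integrable (fun x => ‖x - x₀‖ ^ 2) ρ →
      ∫⁻ x, ENNReal.ofReal (f₀ x) * ‖x - x₀‖ₑ ^ 2 ∂ρ =
        ENNReal.ofReal (sndMoment x₀ ρ - ∫ x, ψ x ∂ρ) := fun ρ _ hρ => by
    rw [sndMoment, ← integral_sub hρ (ψ.integrable ρ),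
      ofReal_integral_eq_lintegral_ofReal (f := fun x => ‖x - x₀‖ ^ 2 - ψ x)
        (hρ.sub (ψ.integrable ρ)) (Filter.Eventually.of_forall fun x => by
          simp only [← hf₀eq]
          exact mul_nonneg (hf₀n x) (by positivity))]
    refine lintegral_congr fun x => ?_
    rw [← hf₀eq, ENNReal.ofReal_mul (hf₀n x), ENNReal.ofReal_pow (norm_nonneg _), ofReal_norm]
  have htail : Filter.Tendsto (fun n => ∫⁻ x, ENNReal.ofReal (f₀ x) * ‖x - x₀‖ₑ ^ 2 ∂(P n))
      Filter.atTop (nhds (∫⁻ x, ENNReal.ofReal (f₀ x) * ‖x - x₀‖ₑ ^ 2 ∂Q)) := by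
    rw [htaileq Q hQ]
    simp_rw [fun n => htaileq (P n) (hP n)]
    exact ENNReal.tendsto_ofReal (hM.sub (hw ψ))
  have htailQ : ∫⁻ x, ENNReal.ofReal (f₀ x) * ‖x - x₀‖ₑ ^ 2 ∂Q ≤ ENNReal.ofReal (δ / 8) := by
    rw [htaileq Q hQ]
    refine ENNReal.ofReal_le_ofReal (le_trans ?_ hN.le)
    rw [sndMoment, ← integral_sub hQ (ψ.integrable Q)]
    refine integral_mono (hQ.sub (ψ.integrable Q)) (hQ.indicator
      (measurableSet_lt measurable_const (by fun_prop))) fun x => ?_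
    change ‖x - x₀‖ ^ 2 - ψ x ≤ _
    rw [← hf₀eq]
    by_cases h0 : f₀ x = 0
    · rw [h0, zero_mul]
      exact Set.indicator_nonneg (fun _ _ => by positivity) _
    · have hx : x ∈ {x | (N : ℝ) < ‖x - x₀‖} := hsupp₀ x h0
      rw [Set.indicator_of_mem hx]
      exact mul_le_of_le_one_left (by positivity) (hf₀1 x)
  have hle1 : ∀ i x, ENNReal.ofReal (f i x) ≤ 1 := fun i x => by
    simpa using ENNReal.ofReal_le_ofReal (hf1 i x)
  have hQfin : ∀ i, ∫⁻ x, ENNReal.ofReal (f i x) ∂Q ≠ ⊤ := fun i =>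
    ne_of_lt (lt_of_le_of_lt (lintegral_mono (hle1 i)) (by simp))
  have henorm : ∀ (v : Euc d) (r : ℝ), ‖v‖ ≤ r → ‖v‖ₑ ^ 2 ≤ ENNReal.ofReal (r ^ 2) :=
    fun v r h => by
      rw [← ofReal_norm, ← ENNReal.ofReal_pow (norm_nonneg _)]
      exact ENNReal.ofReal_le_ofReal (by gcongr)
  have hsub : Filter.Tendsto (fun n => ∑ i, ENNReal.ofReal ((N + ε) ^ 2) *
      (∫⁻ x, ENNReal.ofReal (f i x) ∂(P n) - ∫⁻ x, ENNReal.ofReal (f i x) ∂Q)) Filter.atTop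
      (nhds (∑ i, ENNReal.ofReal ((N + ε) ^ 2) *
        (∫⁻ x, ENNReal.ofReal (f i x) ∂Q - ∫⁻ x, ENNReal.ofReal (f i x) ∂Q))) :=
    tendsto_finsetSum _ fun i _ => ENNReal.Tendsto.const_mul
      (ENNReal.Tendsto.sub (hbump i) tendsto_const_nhds (Or.inl (hQfin i)))
      (Or.inr ENNReal.ofReal_ne_top)
  have hsub' : Filter.Tendsto (fun n => ∑ i, ENNReal.ofReal ((N + ε) ^ 2) *
      (∫⁻ x, ENNReal.ofReal (f i x) ∂Q - ∫⁻ x, ENNReal.ofReal (f i x) ∂(P n))) Filter.atTop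
      (nhds (∑ i, ENNReal.ofReal ((N + ε) ^ 2) *
        (∫⁻ x, ENNReal.ofReal (f i x) ∂Q - ∫⁻ x, ENNReal.ofReal (f i x) ∂Q))) :=
    tendsto_finsetSum _ fun i _ => ENNReal.Tendsto.const_mul
      (ENNReal.Tendsto.sub tendsto_const_nhds (hbump i) (Or.inl (hQfin i)))
      (Or.inr ENNReal.ofReal_ne_top)
  have hlim := (ENNReal.Tendsto.const_mul (a := 2) ((htail.add hsub).add
    ((tendsto_const_nhds (x := ∫⁻ x, ENNReal.ofReal (f₀ x) * ‖x - x₀‖ₑ ^ 2 ∂Q)).add hsub'))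
    (Or.inr ENNReal.ofNat_ne_top)).add
    (tendsto_const_nhds (x := ENNReal.ofReal ((2 * ε) ^ 2)))
  have hlt : (2 : ℝ≥0∞) * ((∫⁻ x, ENNReal.ofReal (f₀ x) * ‖x - x₀‖ₑ ^ 2 ∂Q +
      ∑ i, ENNReal.ofReal ((N + ε) ^ 2) *
        (∫⁻ x, ENNReal.ofReal (f i x) ∂Q - ∫⁻ x, ENNReal.ofReal (f i x) ∂Q)) +
      (∫⁻ x, ENNReal.ofReal (f₀ x) * ‖x - x₀‖ₑ ^ 2 ∂Q +
      ∑ i, ENNReal.ofReal ((N + ε) ^ 2) *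
        (∫⁻ x, ENNReal.ofReal (f i x) ∂Q - ∫⁻ x, ENNReal.ofReal (f i x) ∂Q))) +
      ENNReal.ofReal ((2 * ε) ^ 2) < ENNReal.ofReal δ := by
    simp only [tsub_self, mul_zero, Finset.sum_const_zero, add_zero]
    calc _ ≤ 2 * (ENNReal.ofReal (δ / 8) + ENNReal.ofReal (δ / 8)) +
          ENNReal.ofReal ((2 * ε) ^ 2) := by gcongr
      _ = ENNReal.ofReal (2 * (δ / 8 + δ / 8) + (2 * ε) ^ 2) := by
          rw [ENNReal.ofReal_add (by positivity) (by positivity),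
            ENNReal.ofReal_mul (by positivity), ENNReal.ofReal_add (by positivity) (by positivity),
            ENNReal.ofReal_ofNat]
      _ < _ := (ENNReal.ofReal_lt_ofReal_iff hδ).mpr (by linarith)
  filter_upwards [hlim.eventually (gt_mem_nhds hlt)] with n hn
  obtain ⟨π, h1, h2, h3⟩ := exists_coupling_of_partition x₀ (μ := P n) (ν := Q)
    (f₀ := fun x => ENNReal.ofReal (f₀ x)) (f := fun i x => ENNReal.ofReal (f i x))
    (by fun_prop) (fun i => (hf i).measurable.ennreal_ofReal) (fun x => by
      rw [← ENNReal.ofReal_sum_of_nonneg fun i _ => hfn i x,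
        ← ENNReal.ofReal_add (hf₀n x) (Finset.sum_nonneg fun i _ => hfn i x), hsum,
        ENNReal.ofReal_one])
    (c := ENNReal.ofReal ((2 * ε) ^ 2)) (R := ENNReal.ofReal ((N + ε) ^ 2))
    (fun i x y hx hy => henorm _ _ (hdiam i x y (fun h => hx (by simp [h]))
      (fun h => hy (by simp [h]))))
    (fun i x hx => henorm _ _ (hsupp i x (fun h => hx (by simp [h]))))
  exact W2sq_le_of_lintegral_le h1 h2 hδ.le (h3.trans hn.le)

lemma integrable_comp_fst {P : Measure (Euc d)} {π : Measure (Euc d × Euc d)}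
    (h1 : π.map Prod.fst = P) {f : Euc d → ℝ} (hf : Integrable f P) :
    Integrable (fun p => f p.1) π :=
  (h1 ▸ hf).comp_measurable measurable_fst

lemma integrable_comp_snd {Q : Measure (Euc d)} {π : Measure (Euc d × Euc d)}
    (h2 : π.map Prod.snd = Q) {f : Euc d → ℝ} (hf : Integrable f Q) :
    Integrable (fun p => f p.2) π :=
  (h2 ▸ hf).comp_measurable measurable_snd

lemma integral_comp_fst {P : Measure (Euc d)} {π : Measure (Euc d × Euc d)}
    (h1 : π.map Prod.fst = P) {f : Euc d → ℝ} (hf : Integrable f P) :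
    ∫ p, f p.1 ∂π = ∫ x, f x ∂P := by
  subst h1
  exact (integral_map measurable_fst.aemeasurable hf.aestronglyMeasurable).symm

lemma integral_comp_snd {Q : Measure (Euc d)} {π : Measure (Euc d × Euc d)}
    (h2 : π.map Prod.snd = Q) {f : Euc d → ℝ} (hf : Integrable f Q) :
    ∫ p, f p.2 ∂π = ∫ x, f x ∂Q := by
  subst h2
  exact (integral_map measurable_snd.aemeasurable hf.aestronglyMeasurable).symm

lemma norm_add_sq_le_two_mul (v w : Euc d) : ‖v + w‖ ^ 2 ≤ 2 * ‖v‖ ^ 2 + 2 * ‖w‖ ^ 2 := by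
  nlinarith [norm_add_le v w, norm_nonneg (v + w), sq_nonneg (‖v‖ - ‖w‖)]

lemma norm_sub_sq_le_two_mul (x₀ x y : Euc d) :
    ‖x - y‖ ^ 2 ≤ 2 * ‖x - x₀‖ ^ 2 + 2 * ‖y - x₀‖ ^ 2 := by
  have h := norm_add_sq_le_two_mul (x - x₀) (x₀ - y)
  rwa [sub_add_sub_cancel, norm_sub_rev x₀ y] at h

lemma integrable_cost (x₀ : Euc d) {P Q : Measure (Euc d)} {π : Measure (Euc d × Euc d)}
    (h1 : π.map Prod.fst = P) (h2 : π.map Prod.snd = Q)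
    (hP : Integrable (fun x => ‖x - x₀‖ ^ 2) P) (hQ : Integrable (fun x => ‖x - x₀‖ ^ 2) Q) :
    Integrable (fun p : Euc d × Euc d => ‖p.1 - p.2‖ ^ 2) π := by
  refine (((integrable_comp_fst h1 hP).const_mul 2).add
    ((integrable_comp_snd h2 hQ).const_mul 2)).mono' (by fun_prop)
    (Filter.Eventually.of_forall fun p => ?_)
  rw [Real.norm_of_nonneg (by positivity)]
  exact norm_sub_sq_le_two_mul x₀ p.1 p.2

lemma W2sq_le_sndMoment (x₀ : Euc d) {P Q : Measure (Euc d)} [IsProbabilityMeasure P]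
    [IsProbabilityMeasure Q] (hP : Integrable (fun x => ‖x - x₀‖ ^ 2) P)
    (hQ : Integrable (fun x => ‖x - x₀‖ ^ 2) Q) :
    W2sq P Q ≤ 2 * sndMoment x₀ P + 2 * sndMoment x₀ Q := by
  have h1 := map_fst_prodCoupling P Q (by simp)
  have h2 := map_snd_prodCoupling P Q (by simp)
  have hP' := (integrable_comp_fst h1 hP).const_mul 2
  have hQ' := (integrable_comp_snd h2 hQ).const_mul 2
  refine (W2sq_le_integral h1 h2).trans ?_
  calc _ ≤ ∫ p, (2 * ‖p.1 - x₀‖ ^ 2 + 2 * ‖p.2 - x₀‖ ^ 2) ∂(prodCoupling P Q) :=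
        integral_mono (integrable_cost x₀ h1 h2 hP hQ) (hP'.add hQ')
          fun p => norm_sub_sq_le_two_mul x₀ p.1 p.2
    _ = _ := by
        rw [integral_add hP' hQ', integral_const_mul, integral_const_mul,
          integral_comp_fst h1 hP, integral_comp_snd h2 hQ, sndMoment, sndMoment]

lemma abs_integral_sub_le_W2sq (x₀ : Euc d) {P Q : Measure (Euc d)} [IsProbabilityMeasure P]
    [IsProbabilityMeasure Q] (hP : Integrable (fun x => ‖x - x₀‖ ^ 2) P)
    (hQ : Integrable (fun x => ‖x - x₀‖ ^ 2) Q) {f : Euc d → ℝ} (hfP : Integrable f P)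
    (hfQ : Integrable f Q) {A η : ℝ} (hA : 0 ≤ A)
    (h : ∀ x y, |f x - f y| ≤ A * ‖x - y‖ ^ 2 + η * (1 + ‖y - x₀‖ ^ 2)) :
    |∫ x, f x ∂P - ∫ x, f x ∂Q| ≤ A * W2sq P Q + η * (1 + sndMoment x₀ Q) := by
  refine le_mul_W2sq_add hA fun π h1 h2 => ?_
  have hQ1 : Integrable (fun x => 1 + ‖x - x₀‖ ^ 2) Q := (integrable_const 1).add hQ
  have hf1 := integrable_comp_fst h1 hfP
  have hf2 := integrable_comp_snd h2 hfQ
  have hc := (integrable_cost x₀ h1 h2 hP hQ).const_mul A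
  have hm := (integrable_comp_snd h2 hQ1).const_mul η
  have hMQ : 1 + sndMoment x₀ Q = ∫ x, (1 + ‖x - x₀‖ ^ 2) ∂Q := by
    rw [integral_add (integrable_const 1) hQ]
    simp [sndMoment]
  rw [hMQ, ← integral_comp_fst h1 hfP, ← integral_comp_snd h2 hfQ, ← integral_sub hf1 hf2,
    ← integral_comp_snd h2 hQ1, ← integral_const_mul, ← integral_const_mul,
    ← integral_add hc hm]
  exact abs_integral_le_integral_abs.trans
    (integral_mono (hf1.sub hf2).abs (hc.add hm) fun p => h p.1 p.2)

lemma tendsto_integral_of_W2sq (x₀ : Euc d) {P : ℕ → Measure (Euc d)} {Q : Measure (Euc d)}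
    [∀ n, IsProbabilityMeasure (P n)] [IsProbabilityMeasure Q]
    (hP : ∀ n, Integrable (fun x => ‖x - x₀‖ ^ 2) (P n))
    (hQ : Integrable (fun x => ‖x - x₀‖ ^ 2) Q)
    (hW : Filter.Tendsto (fun n => W2sq (P n) Q) Filter.atTop (nhds 0))
    {f : Euc d → ℝ} (hfP : ∀ n, Integrable f (P n)) (hfQ : Integrable f Q)
    (h : ∀ η : ℝ, 0 < η → ∃ A : ℝ, 0 ≤ A ∧
      ∀ x y, |f x - f y| ≤ A * ‖x - y‖ ^ 2 + η * (1 + ‖y - x₀‖ ^ 2)) :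
    Filter.Tendsto (fun n => ∫ x, f x ∂(P n)) Filter.atTop (nhds (∫ x, f x ∂Q)) := by
  rw [Metric.tendsto_nhds]
  intro δ hδ
  have hM : 0 ≤ sndMoment x₀ Q := integral_nonneg fun x => by positivity
  obtain ⟨A, hA, hAf⟩ := h (δ / (2 * (1 + sndMoment x₀ Q))) (by positivity)
  have hlim := hW.const_mul A
  rw [mul_zero] at hlim
  filter_upwards [hlim.eventually (gt_mem_nhds (half_pos hδ))] with n hn
  have h1 := abs_integral_sub_le_W2sq x₀ (hP n) hQ (hfP n) hfQ hA hAf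
  have h2 : δ / (2 * (1 + sndMoment x₀ Q)) * (1 + sndMoment x₀ Q) = δ / 2 := by field_simp
  rw [Real.dist_eq]
  linarith

lemma tendsto_sndMoment_of_W2sq (x₀ : Euc d) {P : ℕ → Measure (Euc d)} {Q : Measure (Euc d)}
    [∀ n, IsProbabilityMeasure (P n)] [IsProbabilityMeasure Q]
    (hP : ∀ n, Integrable (fun x => ‖x - x₀‖ ^ 2) (P n))
    (hQ : Integrable (fun x => ‖x - x₀‖ ^ 2) Q)
    (hW : Filter.Tendsto (fun n => W2sq (P n) Q) Filter.atTop (nhds 0)) :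
    Filter.Tendsto (fun n => sndMoment x₀ (P n)) Filter.atTop (nhds (sndMoment x₀ Q)) := by
  refine tendsto_integral_of_W2sq x₀ hP hQ hW hP hQ fun η hη => ⟨1 + 1 / η, by positivity, ?_⟩
  intro x y
  have h1 : |‖x - x₀‖ - ‖y - x₀‖| ≤ ‖x - y‖ := by
    simpa using abs_norm_sub_norm_le (x - x₀) (y - x₀)
  have h2 : |‖x - x₀‖ ^ 2 - ‖y - x₀‖ ^ 2| ≤ ‖x - y‖ * (‖x - y‖ + 2 * ‖y - x₀‖) := by
    rw [sq_sub_sq, abs_mul, mul_comm]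
    gcongr
    rw [abs_of_nonneg (by positivity)]
    linarith [le_abs_self (‖x - x₀‖ - ‖y - x₀‖)]
  have h3 : 2 * (‖x - y‖ * ‖y - x₀‖) ≤ 1 / η * ‖x - y‖ ^ 2 + η * ‖y - x₀‖ ^ 2 := by
    have : 0 ≤ 1 / η * (‖x - y‖ - η * ‖y - x₀‖) ^ 2 := by positivity
    have e : 1 / η * (‖x - y‖ - η * ‖y - x₀‖) ^ 2 =
        1 / η * ‖x - y‖ ^ 2 - 2 * (‖x - y‖ * ‖y - x₀‖) + η * ‖y - x₀‖ ^ 2 := by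
      field_simp
      ring
    linarith
  nlinarith

lemma tendsto_integral_boundedContinuous_of_W2sq (x₀ : Euc d) {P : ℕ → Measure (Euc d)}
    {Q : Measure (Euc d)} [∀ n, IsProbabilityMeasure (P n)] [IsProbabilityMeasure Q]
    (hP : ∀ n, Integrable (fun x => ‖x - x₀‖ ^ 2) (P n))
    (hQ : Integrable (fun x => ‖x - x₀‖ ^ 2) Q)
    (hW : Filter.Tendsto (fun n => W2sq (P n) Q) Filter.atTop (nhds 0))
    (φ : BoundedContinuousFunction (Euc d) ℝ) :
    Filter.Tendsto (fun n => ∫ x, φ x ∂(P n)) Filter.atTop (nhds (∫ x, φ x ∂Q)) := by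
  let P' : ℕ → ProbabilityMeasure (Euc d) := fun n => ⟨P n, inferInstance⟩
  let Q' : ProbabilityMeasure (Euc d) := ⟨Q, inferInstance⟩
  have key : Filter.Tendsto P' Filter.atTop (nhds Q') := by
    rw [tendsto_iff_forall_lipschitz_integral_tendsto]
    rintro f ⟨C, hC⟩ ⟨L, hL⟩
    have hint : ∀ (ρ : Measure (Euc d)) [IsProbabilityMeasure ρ], Integrable f ρ := fun ρ _ =>
      (BoundedContinuousFunction.mkOfBound ⟨f, hL.continuous⟩ C hC).integrable ρ
    refine tendsto_integral_of_W2sq x₀ hP hQ hW (fun n => hint _) (hint _) fun η hη =>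
      ⟨L ^ 2 / η, by positivity, fun x y => ?_⟩
    have h1 : |f x - f y| ≤ L * ‖x - y‖ := by
      simpa [Real.dist_eq, dist_eq_norm] using hL.dist_le_mul x y
    have h2 : L * ‖x - y‖ ≤ L ^ 2 / η * ‖x - y‖ ^ 2 + η := by
      rw [div_mul_eq_mul_div, ← sub_le_iff_le_add, le_div_iff₀ hη]
      nlinarith [sq_nonneg (L * ‖x - y‖ - η), mul_nonneg L.2 (norm_nonneg (x - y))]
    nlinarith [mul_nonneg hη.le (sq_nonneg ‖y - x₀‖)]
  exact ProbabilityMeasure.tendsto_iff_forall_integral_tendsto.mp key φ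

lemma continuous_dil (x₀ : Euc d) (a : ℝ) : Continuous (dil x₀ a) := by
  unfold dil
  fun_prop

lemma norm_dil_sub (x₀ : Euc d) (a : ℝ) (x : Euc d) :
    ‖dil x₀ a x - x₀‖ ^ 2 = a ^ 2 * ‖x - x₀‖ ^ 2 := by
  rw [dil, add_sub_cancel_right, norm_smul, mul_pow, Real.norm_eq_abs, sq_abs]

lemma map_dil_map_dil_inv (x₀ : Euc d) {a : ℝ} (ha : a ≠ 0) (P : Measure (Euc d)) :
    (P.map (dil x₀ a)).map (dil x₀ a⁻¹) = P := by
  rw [Measure.map_map (continuous_dil _ _).measurable (continuous_dil _ _).measurable]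
  have : dil x₀ a⁻¹ ∘ dil x₀ a = id := by
    funext x
    simp [dil, smul_smul, inv_mul_cancel₀ ha]
  rw [this, Measure.map_id]

lemma integrable_map_dil (x₀ : Euc d) (a : ℝ) {P : Measure (Euc d)}
    (hP : Integrable (fun x => ‖x - x₀‖ ^ 2) P) :
    Integrable (fun x => ‖x - x₀‖ ^ 2) (P.map (dil x₀ a)) := by
  rw [integrable_map_measure (by fun_prop) (continuous_dil _ _).measurable.aemeasurable]
  simpa only [Function.comp_def, norm_dil_sub] using hP.const_mul (a ^ 2)

lemma W2sq_map_dil_le (x₀ : Euc d) (a b : ℝ) {P Q : Measure (Euc d)} [IsProbabilityMeasure P]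
    [IsProbabilityMeasure Q] (hP : Integrable (fun x => ‖x - x₀‖ ^ 2) P)
    (hQ : Integrable (fun x => ‖x - x₀‖ ^ 2) Q) :
    W2sq (P.map (dil x₀ a)) (Q.map (dil x₀ b)) ≤
      2 * a ^ 2 * W2sq P Q + 2 * (a - b) ^ 2 * sndMoment x₀ Q := by
  refine le_mul_W2sq_add (by positivity) fun π h1 h2 => ?_
  have ha := (continuous_dil x₀ a).measurable
  have hb := (continuous_dil x₀ b).measurable
  have hT : Measurable fun p : Euc d × Euc d => (dil x₀ a p.1, dil x₀ b p.2) :=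
    (ha.comp measurable_fst).prodMk (hb.comp measurable_snd)
  have hc := (integrable_cost x₀ h1 h2 hP hQ).const_mul (2 * a ^ 2)
  have hm := (integrable_comp_snd h2 hQ).const_mul (2 * (a - b) ^ 2)
  refine (W2sq_le_integral (π := π.map fun p => (dil x₀ a p.1, dil x₀ b p.2)) ?_ ?_).trans ?_
  · rw [Measure.map_map measurable_fst hT, ← h1, Measure.map_map ha measurable_fst]
    rfl
  · rw [Measure.map_map measurable_snd hT, ← h2, Measure.map_map hb measurable_snd]
    rfl
  rw [integral_map hT.aemeasurable (by fun_prop), sndMoment, ← integral_comp_snd h2 hQ,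
    ← integral_const_mul, ← integral_const_mul, ← integral_add hc hm]
  refine integral_mono_of_nonneg (Filter.Eventually.of_forall fun p => by positivity)
    (hc.add hm) (Filter.Eventually.of_forall fun p => ?_)
  have e : dil x₀ a p.1 - dil x₀ b p.2 = a • (p.1 - p.2) + (a - b) • (p.2 - x₀) := by
    simp only [dil]
    module
  have h := norm_add_sq_le_two_mul (a • (p.1 - p.2)) ((a - b) • (p.2 - x₀))
  rw [← e, norm_smul, norm_smul, mul_pow, mul_pow, Real.norm_eq_abs, Real.norm_eq_abs, sq_abs,
    sq_abs] at h
  simp only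
  linarith

lemma isProbabilityMeasure_nm (x₀ : Euc d) (μ : Measure (Euc d)) [IsFiniteMeasure μ] :
    IsProbabilityMeasure (nm x₀ μ) := by
  unfold nm
  split_ifs with h
  · infer_instance
  · exact ⟨by simp [ENNReal.inv_mul_cancel h (measure_ne_top _ _)]⟩

lemma integral_eq_mass_mul (x₀ : Euc d) (μ : Measure (Euc d)) [IsFiniteMeasure μ]
    (f : Euc d → ℝ) : ∫ x, f x ∂μ = mass μ * ∫ x, f x ∂(nm x₀ μ) := by
  unfold nm mass
  split_ifs with h
  · simp [Measure.measure_univ_eq_zero.mp h]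
  · rw [integral_smul_measure, ENNReal.toReal_inv, smul_eq_mul, mul_inv_cancel_left₀]
    exact (ENNReal.toReal_pos h (measure_ne_top _ _)).ne'

lemma sndMoment_eq_mass_mul (x₀ : Euc d) (μ : Measure (Euc d)) [IsFiniteMeasure μ] :
    sndMoment x₀ μ = mass μ * sndMoment x₀ (nm x₀ μ) :=
  integral_eq_mass_mul x₀ μ _

lemma MemM.integrable_norm_sub_sq {μ : Measure (Euc d)} (h : MemM μ) (x₀ : Euc d) :
    Integrable (fun x => ‖x - x₀‖ ^ 2) μ := by
  have := h.1
  refine ((h.2.const_mul 2).add (integrable_const (2 * ‖x₀‖ ^ 2))).mono' (by fun_prop)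
    (Filter.Eventually.of_forall fun x => ?_)
  rw [Real.norm_of_nonneg (by positivity)]
  simpa [sub_eq_add_neg] using norm_add_sq_le_two_mul x (-x₀)

lemma MemM.integrable_nm {μ : Measure (Euc d)} (h : MemM μ) (x₀ : Euc d) :
    Integrable (fun x => ‖x - x₀‖ ^ 2) (nm x₀ μ) := by
  unfold nm
  split_ifs with h0
  · exact integrable_dirac (by simp)
  · exact (h.integrable_norm_sub_sq x₀).smul_measure (ENNReal.inv_ne_top.mpr h0)

lemma sndMoment_nonneg (x₀ : Euc d) (μ : Measure (Euc d)) : 0 ≤ sndMoment x₀ μ :=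
  integral_nonneg fun x => by positivity

lemma mass_nonneg (μ : Measure (Euc d)) : 0 ≤ mass μ := ENNReal.toReal_nonneg

lemma MemMK.sndMoment_nm_le {x₀ : Euc d} {K : ℝ} {μ : Measure (Euc d)} (hK : 0 ≤ K)
    (h : MemMK x₀ K μ) : sndMoment x₀ (nm x₀ μ) ≤ K := by
  have := h.1.1
  rcases (mass_nonneg μ).eq_or_lt with h0 | h0
  · have h0' : μ Set.univ = 0 := by
      rw [mass, eq_comm, ENNReal.toReal_eq_zero_iff] at h0
      exact h0.resolve_right (measure_ne_top _ _)
    simpa [sndMoment, nm, h0'] using hK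
  · have h1 := h.2
    rw [sndMoment_eq_mass_mul, mul_comm K] at h1
    exact le_of_mul_le_mul_left h1 h0

lemma WOP2_nonneg (x₀ : Euc d) (μ ν : Measure (Euc d)) : 0 ≤ WOP2 x₀ μ ν :=
  add_nonneg (sq_nonneg _) (W2sq_nonneg _ _)

lemma tendsto_WOP_iff (x₀ : Euc d) (μ : ℕ → Measure (Euc d)) (ν : Measure (Euc d)) :
    Filter.Tendsto (fun n => WOP x₀ (μ n) ν) Filter.atTop (nhds 0) ↔
      Filter.Tendsto (fun n => mass (μ n)) Filter.atTop (nhds (mass ν)) ∧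
      Filter.Tendsto (fun n => W2sq ((nm x₀ (μ n)).map (dil x₀ (mass (μ n))))
        ((nm x₀ ν).map (dil x₀ (mass ν)))) Filter.atTop (nhds 0) := by
  constructor
  · intro h
    have h2 : Filter.Tendsto (fun n => WOP2 x₀ (μ n) ν) Filter.atTop (nhds 0) := by
      simpa [WOP, Real.sq_sqrt (WOP2_nonneg _ _ _)] using h.pow 2
    refine ⟨?_, squeeze_zero (fun n => W2sq_nonneg _ _)
      (fun n => le_add_of_nonneg_left (sq_nonneg _)) h2⟩
    rw [tendsto_iff_dist_tendsto_zero]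
    refine squeeze_zero (fun n => dist_nonneg) (fun n => ?_) h
    rw [Real.dist_eq]
    exact Real.abs_le_sqrt (le_add_of_nonneg_right (W2sq_nonneg _ _))
  · rintro ⟨h1, h2⟩
    have h3 := (((h1.sub_const (mass ν)).pow 2).add h2).sqrt
    simpa [WOP, WOP2] using h3

lemma tendsto_W2sq_map_dil (x₀ : Euc d) {P : ℕ → Measure (Euc d)} {Q : Measure (Euc d)}
    [∀ n, IsProbabilityMeasure (P n)] [IsProbabilityMeasure Q]
    (hP : ∀ n, Integrable (fun x => ‖x - x₀‖ ^ 2) (P n))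
    (hQ : Integrable (fun x => ‖x - x₀‖ ^ 2) Q) {a : ℕ → ℝ} {b : ℝ}
    (hab : Filter.Tendsto a Filter.atTop (nhds b))
    (hW : Filter.Tendsto (fun n => a n ^ 2 * W2sq (P n) Q) Filter.atTop (nhds 0)) :
    Filter.Tendsto (fun n => W2sq ((P n).map (dil x₀ (a n))) (Q.map (dil x₀ b)))
      Filter.atTop (nhds 0) := by
  refine squeeze_zero (fun n => W2sq_nonneg _ _)
    (fun n => W2sq_map_dil_le x₀ (a n) b (hP n) hQ) ?_
  have h := (hW.const_mul 2).add ((((hab.sub_const b).pow 2).const_mul 2).mul_const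
    (sndMoment x₀ Q))
  simpa [mul_assoc] using h

/-- on `M_K(ℝ^d)`, `WOP` metrizes weak convergence together with the
convergence of second moments. -/
theorem WOP_metrizes_weak_convergence (d : ℕ) (x₀ : Euc d) (K : ℝ) (hK : 0 < K)
    (μ : ℕ → Measure (Euc d)) (ν : Measure (Euc d))
    (hmem : ∀ n, MemMK x₀ K (μ n)) (hν : MemMK x₀ K ν) :
    Filter.Tendsto (fun n => WOP x₀ (μ n) ν) Filter.atTop (nhds 0) ↔
      (Filter.Tendsto (fun n => sndMoment x₀ (μ n)) Filter.atTop (nhds (sndMoment x₀ ν)) ∧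
        ∀ φ : BoundedContinuousFunction (Euc d) ℝ,
          Filter.Tendsto (fun n => ∫ x, φ x ∂(μ n)) Filter.atTop (nhds (∫ x, φ x ∂ν))) := by
  have hfin := fun n => (hmem n).1.1
  have hfinν := hν.1.1
  have hprob := fun n => isProbabilityMeasure_nm x₀ (μ n)
  have hprobν := isProbabilityMeasure_nm x₀ ν
  have hint := fun n => (hmem n).1.integrable_nm x₀
  have hintν := hν.1.integrable_nm x₀
  rw [tendsto_WOP_iff]
  constructor
  · rintro ⟨hmass, hW⟩
    rcases eq_or_ne (mass ν) 0 with h0 | h0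
    · rw [h0] at hmass
      have hν0 : ∀ f : Euc d → ℝ, ∫ x, f x ∂ν = 0 := fun f => by
        rw [integral_eq_mass_mul x₀, h0, zero_mul]
      refine ⟨?_, fun φ => ?_⟩
      · rw [sndMoment, hν0]
        refine squeeze_zero (fun n => sndMoment_nonneg _ _) (fun n => (hmem n).2) ?_
        simpa using hmass.const_mul K
      · rw [hν0]
        refine squeeze_zero_norm (fun n => ?_) (by simpa using hmass.mul_const ‖φ‖)
        rw [mul_comm]
        exact norm_integral_le_of_norm_le_const
          (Filter.Eventually.of_forall fun x => φ.norm_coe_le_norm x)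
    · have hpos : ∀ᶠ n in Filter.atTop, mass (μ n) ≠ 0 := hmass.eventually_ne h0
      have hprob' : ∀ n, IsProbabilityMeasure ((nm x₀ (μ n)).map (dil x₀ (mass (μ n)))) :=
        fun n => Measure.isProbabilityMeasure_map
          (continuous_dil x₀ (mass (μ n))).measurable.aemeasurable
      have hprobν' : IsProbabilityMeasure ((nm x₀ ν).map (dil x₀ (mass ν))) :=
        Measure.isProbabilityMeasure_map (continuous_dil x₀ (mass ν)).measurable.aemeasurable
      have hinv := hmass.inv₀ h0
      have hW' : Filter.Tendsto (fun n => W2sq (nm x₀ (μ n)) (nm x₀ ν)) Filter.atTop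
          (nhds 0) := by
        refine (tendsto_W2sq_map_dil x₀ (fun n => integrable_map_dil x₀ (mass (μ n)) (hint n))
          (integrable_map_dil x₀ (mass ν) hintν) hinv ?_).congr' ?_
        · simpa using (hinv.pow 2).mul hW
        · filter_upwards [hpos] with n hn
          rw [map_dil_map_dil_inv x₀ hn, map_dil_map_dil_inv x₀ h0]
      refine ⟨?_, fun φ => ?_⟩
      · rw [sndMoment_eq_mass_mul x₀ ν, funext fun n => sndMoment_eq_mass_mul x₀ (μ n)]
        exact hmass.mul (tendsto_sndMoment_of_W2sq x₀ hint hintν hW')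
      · rw [integral_eq_mass_mul x₀ ν, funext fun n => integral_eq_mass_mul x₀ (μ n) φ]
        exact hmass.mul (tendsto_integral_boundedContinuous_of_W2sq x₀ hint hintν hW' φ)
  · rintro ⟨hM, hw⟩
    have hmass : Filter.Tendsto (fun n => mass (μ n)) Filter.atTop (nhds (mass ν)) := by
      simpa [mass, Measure.real] using hw (BoundedContinuousFunction.const _ 1)
    refine ⟨hmass, tendsto_W2sq_map_dil x₀ hint hintν hmass ?_⟩
    rcases eq_or_ne (mass ν) 0 with h0 | h0
    · refine squeeze_zero (fun n => mul_nonneg (sq_nonneg _) (W2sq_nonneg _ _)) (fun n => ?_)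
        (by simpa [h0] using (hmass.pow 2).mul_const (2 * K + 2 * K))
      gcongr
      refine (W2sq_le_sndMoment x₀ (hint n) hintν).trans ?_
      gcongr
      · exact (hmem n).sndMoment_nm_le hK.le
      · exact hν.sndMoment_nm_le hK.le
    · have hpos : ∀ᶠ n in Filter.atTop, mass (μ n) ≠ 0 := hmass.eventually_ne h0
      have hdiv : ∀ f : Euc d → ℝ,
          Filter.Tendsto (fun n => ∫ x, f x ∂(μ n)) Filter.atTop (nhds (∫ x, f x ∂ν)) →
          Filter.Tendsto (fun n => ∫ x, f x ∂(nm x₀ (μ n))) Filter.atTop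
            (nhds (∫ x, f x ∂(nm x₀ ν))) := fun f hf => by
        have h := (hmass.inv₀ h0).mul hf
        rw [integral_eq_mass_mul x₀ ν, inv_mul_cancel_left₀ h0] at h
        refine h.congr' ?_
        filter_upwards [hpos] with n hn
        rw [integral_eq_mass_mul x₀ (μ n), inv_mul_cancel_left₀ hn]
      have hW := tendsto_W2sq_of_weak x₀ hint hintν (hdiv _ hM) fun φ => hdiv φ (hw φ)
      simpa using (hmass.pow 2).mul hW

end
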